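/- Let σ, τ be weight functions in the class W₀ with associated weight matrices {S^(ℓ) : ℓ > 0} and {T^(ℓ) : ℓ > 0}. (i) Let α > 0, assume σ(s) = o(s^{1/α}) as s → +∞ and γ(σ) > α. Then for all ℓ, ℓ₁ > 0: γ(ω_{S^(ℓ₁)}) ≤ γ(((((ω_{S^(ℓ)})^α)^⋆)^ι)^{1/α}) + α; and if additionally γ̄(σ) < +∞, then for all ℓ, ℓ₁ > 0: γ̄(((((ω_{S^(ℓ)})^α)^⋆)^ι)^{1/α}) + α ≤ γ̄(ω_{S^(ℓ₁)}). (Here for any weight function ω, ((((ω)^α)^⋆)^ι)^{1/α} = ω ⋆̂ id^{1/α}.) (ii) Assume that either ω_{S^(x)}⋆̂ω_{T^(y)} is well-defined for some x, y > 0 or σ⋆̂τ is well-defined, and that 0 < γ(τ) = γ̄(τ) < γ(σ) ≤ γ̄(σ) < +∞. Then for all ℓ₁, ℓ₂, ℓ₃, ℓ₄, ℓ₅, ℓ₆, ℓ₇, ℓ₈ > 0: γ(ω_{S^(ℓ₁)}) ≤ γ(ω_{S^(ℓ₂)}⋆̂ω_{T^(ℓ₃)}) + γ̄(ω_{T^(ℓ₄)})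 ≤ γ̄(ω_{S^(ℓ₅)}⋆̂ω_{T^(ℓ₆)}) + γ(ω_{T^(ℓ₇)}) ≤ γ̄(ω_{S^(ℓ₈)}). -/

import Mathlib

open Real Filter Asymptotics Set
open scoped ENNReal Topology

noncomputable section

/-- A weight function: nonnegative, non-decreasing on `[0,∞)`, tending to `+∞`. -/
def IsWeightFct (ω : ℝ → ℝ) : Prop :=
  (∀ t : ℝ, 0 ≤ ω t) ∧ MonotoneOn ω (Ici (0:ℝ)) ∧ Tendsto ω atTop atTop

/-- Condition `(ω₁)`: `ω(2t) = O(ω(t))`. -/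
def HasOm1 (ω : ℝ → ℝ) : Prop :=
  ∃ L : ℝ, 1 ≤ L ∧ ∀ t : ℝ, 0 ≤ t → ω (2 * t) ≤ L * (ω t + 1)

/-- Condition `(ω₆)`. -/
def HasOm6 (ω : ℝ → ℝ) : Prop :=
  ∃ H : ℝ, 1 ≤ H ∧ ∀ t : ℝ, 0 ≤ t → 2 * ω t ≤ ω (H * t) + H

/-- The class `W₀` of (normalized) Braun-Meise-Taylor weight functions. -/
def IsW0 (ω : ℝ → ℝ) : Prop :=
  IsWeightFct ω ∧ ContinuousOn ω (Ici (0:ℝ)) ∧ (∀ t ∈ Icc (0:ℝ) 1, ω t = 0) ∧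
    ((fun t : ℝ => Real.log t) =o[atTop] ω) ∧
    ConvexOn ℝ univ (fun y : ℝ => ω (Real.exp y))

/-- Legendre-Fenchel-Young conjugate `φ*_ω`. -/
def phiStar (ω : ℝ → ℝ) (x : ℝ) : ℝ :=
  sSup {z : ℝ | ∃ y : ℝ, 0 ≤ y ∧ z = x * y - ω (Real.exp y)}

/-- The sequence `W^(ℓ)` of the associated weight matrix of `ω`. -/
def assocSeq (ω : ℝ → ℝ) (ℓ : ℝ) (p : ℕ) : ℝ :=
  Real.exp ((1 / ℓ) * phiStar ω (ℓ * (p : ℝ)))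

/-- The weight function `ω_M` associated with a sequence `M`. -/
def omegaSeq (M : ℕ → ℝ) (t : ℝ) : ℝ :=
  sSup {z : ℝ | ∃ p : ℕ, z = Real.log (t ^ p / M p)}

/-- Property `(P_{ω,γ})`. -/
def gammaProp (ω : ℝ → ℝ) (g : ℝ) : Prop :=
  ∃ K : ℝ, 1 < K ∧
    limsup (fun t : ℝ => ((ω (K ^ g * t) / ω t : ℝ) : EReal)) atTop < (K : EReal)

/-- Property `(P̄_{ω,γ})`. -/
def gammaBarProp (ω : ℝ → ℝ) (g : ℝ) : Prop :=
  ∃ A : ℝ, 1 < A ∧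
    (A : EReal) < liminf (fun t : ℝ => ((ω (A ^ g * t) / ω t : ℝ) : EReal)) atTop

/-- The growth index `γ(ω) ∈ [0,∞]`. -/
def gammaIdx (ω : ℝ → ℝ) : ℝ≥0∞ :=
  ⨆ (g : ℝ) (_ : 0 < g ∧ gammaProp ω g), ENNReal.ofReal g

/-- The growth index `γ̄(ω) ∈ [0,∞]` (`+∞` if no admissible `γ` exists). -/
def gammaBarIdx (ω : ℝ → ℝ) : ℝ≥0∞ :=
  sInf (ENNReal.ofReal '' {g : ℝ | 0 < g ∧ gammaBarProp ω g})

/-- Generalized lower Legendre conjugate `σ ⋆̌ τ`. -/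
def lowerConj (σ τ : ℝ → ℝ) (t : ℝ) : ℝ :=
  sInf {z : ℝ | ∃ s : ℝ, 0 < s ∧ z = σ s + τ (t / s)}

/-- Generalized upper Legendre conjugate `σ ⋆̂ τ`. -/
def upperConj (σ τ : ℝ → ℝ) (t : ℝ) : ℝ :=
  if t = 0 then σ 0 - τ 0 else sSup {z : ℝ | ∃ s : ℝ, 0 ≤ s ∧ z = σ s - τ (s / t)}

/-- `σ ⋆̂ τ` is well-defined, i.e. `σ⋆̂τ(t) < +∞` for every `t`. -/
def UpperConjWD (σ τ : ℝ → ℝ) : Prop :=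
  ∀ t : ℝ, 0 < t → BddAbove {z : ℝ | ∃ s : ℝ, 0 ≤ s ∧ z = σ s - τ (s / t)}

/-- Lower Legendre envelope `h_⋆`. -/
def lowerEnv (h : ℝ → ℝ) (t : ℝ) : ℝ :=
  sInf {z : ℝ | ∃ u : ℝ, 0 < u ∧ z = h u + t * u}

/-- Upper Legendre envelope `h^⋆`. -/
def upperEnv (h : ℝ → ℝ) (t : ℝ) : ℝ :=
  sSup {z : ℝ | ∃ s : ℝ, 0 ≤ s ∧ z = h s - t * s}

/-- `(((ω^ι)^α)_⋆)^{1/α}` (which equals `ω ⋆̌ id^{1/α}`). -/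
def lowerCompose (ω : ℝ → ℝ) (α : ℝ) (t : ℝ) : ℝ :=
  lowerEnv (fun u : ℝ => ω (1 / u ^ α)) (t ^ (1 / α))

/-- `(((ω^α)^⋆)^ι)^{1/α}` (which equals `ω ⋆̂ id^{1/α}`). -/
def upperCompose (ω : ℝ → ℝ) (α : ℝ) (t : ℝ) : ℝ :=
  upperEnv (fun s : ℝ => ω (s ^ α)) (1 / t ^ (1 / α))

/-- Equivalence `σ ∼ τ` of weight functions. -/
def WeightEquiv (σ τ : ℝ → ℝ) : Prop :=
  σ =O[atTop] τ ∧ τ =O[atTop] σ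

/-- Relation `M ≼ N` for sequences: `sup_{p ≥ 1} (M_p/N_p)^{1/p} < ∞`. -/
def seqPrec (M N : ℕ → ℝ) : Prop :=
  ∃ C : ℝ, ∀ p : ℕ, 1 ≤ p → (M p / N p) ^ (1 / (p : ℝ)) ≤ C

/-- Relation `M ◁ N` for sequences: `(M_p/N_p)^{1/p} → 0`. -/
def seqTriangle (M N : ℕ → ℝ) : Prop :=
  Tendsto (fun p : ℕ => (M p / N p) ^ (1 / (p : ℝ))) atTop (𝓝 0)

/-- Equivalence `M ≈ N` of sequences. -/
def seqEquiv (M N : ℕ → ℝ) : Prop := seqPrec M N ∧ seqPrec N M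

/-- The Gevrey sequence `G^α`. -/
def gevrey (α : ℝ) (p : ℕ) : ℝ := (p.factorial : ℝ) ^ α

/-- The quotient sequence `μ_p = M_p / M_{p-1}`, `μ₀ = 1`. -/
def quotSeq (M : ℕ → ℝ) : ℕ → ℝ
  | 0 => 1
  | (p + 1) => M (p + 1) / M p

/-- Condition `(β,Q)`: `liminf_{p} μ_{Qp}/μ_p > Q^β`. -/
def condBQ (M : ℕ → ℝ) (β : ℝ) (Q : ℕ) : Prop :=
  ((((Q : ℝ) ^ β : ℝ)) : EReal) <
    liminf (fun p : ℕ => ((quotSeq M (Q * p) / quotSeq M p : ℝ) : EReal)) atTop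

/-- Thilliez's growth index `γ(M) ∈ [0,∞]`. -/
def thilliezIdx (M : ℕ → ℝ) : ℝ≥0∞ :=
  ⨆ (β : ℝ) (_ : 0 ≤ β ∧ ∃ Q : ℕ, 2 ≤ Q ∧ condBQ M β Q), ENNReal.ofReal β

/-- The Beurling Gelfand-Shilov space `S_(σ)(ℝ)` (membership predicate). -/
def MemSBeurling (σ : ℝ → ℝ) (f : ℝ → ℂ) : Prop :=
  ContDiff ℝ (⊤ : ℕ∞) f ∧ ∀ ℓ : ℝ, 0 < ℓ → ∃ C : ℝ, ∀ x : ℝ, ∀ j k : ℕ,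
    (1 + |x|) ^ k * ‖iteratedDeriv j f x‖ ≤ C * assocSeq σ ℓ (j + k)

/-- The polynomial `ψ(x) = x² + 1/4`. -/
def psiMap (x : ℝ) : ℝ := x ^ 2 + 1 / 4

/-- The resolvent operator `R_μ = ∑_m C_{ψ_m}/μ^{m+1}`. -/
def Rres (μ : ℂ) (f : ℝ → ℂ) (x : ℝ) : ℂ :=
  ∑' m : ℕ, (μ ^ (m + 1))⁻¹ * f (psiMap^[m] x)

lemma bddAbove_phiStar {σ : ℝ → ℝ} (hσ : IsW0 σ) (x : ℝ) :
    BddAbove {z : ℝ | ∃ y : ℝ, 0 ≤ y ∧ z = x * y - σ (Real.exp y)} := by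
  obtain ⟨⟨h0, hm, ht⟩, -, -, ho, -⟩ := hσ
  have hc : (0:ℝ) < 1 / (|x| + 1) := by positivity
  obtain ⟨T, hT⟩ := eventually_atTop.1 (ho.bound hc)
  refine ⟨|x| * |T|, ?_⟩
  rintro z ⟨y, hy, rfl⟩
  have hxy : x * y ≤ |x| * y := mul_le_mul_of_nonneg_right (le_abs_self x) hy
  rcases le_total T (Real.exp y) with h | h
  · have h1 := hT _ h
    rw [Real.log_exp, Real.norm_eq_abs, Real.norm_eq_abs, abs_of_nonneg hy,
      abs_of_nonneg (h0 _), div_mul_eq_mul_div, one_mul, le_div_iff₀ (by positivity)] at h1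
    have : 0 ≤ |x| * |T| := by positivity
    nlinarith
  · have h1 : y ≤ |T| := by
      have := Real.add_one_le_exp y
      have := le_abs_self T
      linarith
    have := mul_le_mul_of_nonneg_left h1 (abs_nonneg x)
    have := h0 (Real.exp y)
    linarith

lemma le_phiStar {σ : ℝ → ℝ} (hσ : IsW0 σ) (x : ℝ) {y : ℝ} (hy : 0 ≤ y) :
    x * y - σ (Real.exp y) ≤ phiStar σ x :=
  le_csSup (bddAbove_phiStar hσ x) ⟨y, hy, rfl⟩

lemma phiStar_nonneg {σ : ℝ → ℝ} (hσ : IsW0 σ) (x : ℝ) : 0 ≤ phiStar σ x := by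
  have h := le_phiStar hσ x le_rfl
  have h1 : σ 1 = 0 := hσ.2.2.1 1 ⟨zero_le_one, le_rfl⟩
  simpa [h1] using h

lemma phiStar_le {σ : ℝ → ℝ} {x c : ℝ}
    (h : ∀ y, 0 ≤ y → x * y - σ (Real.exp y) ≤ c) : phiStar σ x ≤ c := by
  refine csSup_le ⟨_, 0, le_rfl, rfl⟩ ?_
  rintro z ⟨y, hy, rfl⟩
  exact h y hy

lemma phiStar_mono {σ : ℝ → ℝ} (hσ : IsW0 σ) {x x' : ℝ} (h : x ≤ x') :
    phiStar σ x ≤ phiStar σ x' := by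
  refine phiStar_le fun y hy => le_trans ?_ (le_phiStar hσ x' hy)
  have := mul_le_mul_of_nonneg_right h hy
  linarith

/-- A convex non-decreasing function on the line has a supporting line of nonnegative slope. -/
lemma exists_supporting_line {f : ℝ → ℝ} (hf : ConvexOn ℝ univ f) (hm : Monotone f) (y₀ : ℝ) :
    ∃ k : ℝ, 0 ≤ k ∧ ∀ y, f y₀ + k * (y - y₀) ≤ f y := by
  refine ⟨sInf ((fun y => (f y - f y₀) / (y - y₀)) '' Ioi y₀), ?_, ?_⟩
  · refine Real.sInf_nonneg ?_
    rintro _ ⟨y, hy, rfl⟩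
    exact div_nonneg (sub_nonneg.2 (hm (le_of_lt hy))) (sub_nonneg.2 (le_of_lt hy))
  · intro y
    have hb : BddBelow ((fun y => (f y - f y₀) / (y - y₀)) '' Ioi y₀) := by
      refine ⟨0, ?_⟩
      rintro _ ⟨y, hy, rfl⟩
      exact div_nonneg (sub_nonneg.2 (hm (le_of_lt hy))) (sub_nonneg.2 (le_of_lt hy))
    rcases lt_trichotomy y y₀ with h | rfl | h
    · have : (f y₀ - f y) / (y₀ - y) ≤ sInf ((fun y => (f y - f y₀) / (y - y₀)) '' Ioi y₀) := by
        refine le_csInf ((nonempty_Ioi).image _) ?_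
        rintro _ ⟨z, hz, rfl⟩
        exact hf.slope_mono_adjacent (mem_univ y) (mem_univ z) h hz
      rw [div_le_iff₀ (sub_pos.2 h)] at this
      linarith
    · simp
    · have := csInf_le hb ⟨y, h, rfl⟩
      rw [le_div_iff₀ (sub_pos.2 h)] at this
      linarith

lemma log_pow_div_assocSeq (σ : ℝ → ℝ) (ℓ : ℝ) {t : ℝ} (ht : 0 < t) (p : ℕ) :
    Real.log (t ^ p / assocSeq σ ℓ p) = p * Real.log t - 1 / ℓ * phiStar σ (ℓ * p) := by
  rw [assocSeq, Real.log_div (by positivity) (Real.exp_pos _).ne', Real.log_exp, Real.log_pow]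

lemma log_pow_div_assocSeq_le {σ : ℝ → ℝ} (hσ : IsW0 σ) {ℓ : ℝ} (hℓ : 0 < ℓ) {t : ℝ}
    (ht : 0 ≤ t) (p : ℕ) : Real.log (t ^ p / assocSeq σ ℓ p) ≤ σ (max t 1) / ℓ := by
  have hn : 0 ≤ σ (max t 1) / ℓ := div_nonneg (hσ.1.1 _) hℓ.le
  rcases ht.eq_or_lt with rfl | ht
  · rcases p with _ | p
    · refine le_trans ?_ hn
      rw [assocSeq, pow_zero, one_div (Real.exp _), Real.log_inv, Real.log_exp, neg_nonpos]
      exact mul_nonneg (by positivity) (phiStar_nonneg hσ _)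
    · simpa using hn
  · rw [log_pow_div_assocSeq σ ℓ ht]
    have h1 : (0:ℝ) < max t 1 := by positivity
    have h := le_phiStar hσ (ℓ * p) (Real.log_nonneg (le_max_right t 1))
    rw [Real.exp_log h1] at h
    have h2 : Real.log t ≤ Real.log (max t 1) := Real.log_le_log ht (le_max_left _ _)
    have h3 := mul_le_mul_of_nonneg_left h2 (Nat.cast_nonneg (α := ℝ) p)
    have h4 := mul_le_mul_of_nonneg_left h3 hℓ.le
    rw [le_div_iff₀ hℓ]
    have : (p * Real.log t - 1 / ℓ * phiStar σ (ℓ * p)) * ℓ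
        = ℓ * (p * Real.log t) - phiStar σ (ℓ * p) := by field_simp
    rw [this]
    linarith

lemma bddAbove_omegaSeq {σ : ℝ → ℝ} (hσ : IsW0 σ) {ℓ : ℝ} (hℓ : 0 < ℓ) {t : ℝ} (ht : 0 ≤ t) :
    BddAbove {z : ℝ | ∃ p : ℕ, z = Real.log (t ^ p / assocSeq σ ℓ p)} := by
  refine ⟨σ (max t 1) / ℓ, ?_⟩
  rintro z ⟨p, rfl⟩
  exact log_pow_div_assocSeq_le hσ hℓ ht p

lemma omegaSeq_le {σ : ℝ → ℝ} (hσ : IsW0 σ) {ℓ : ℝ} (hℓ : 0 < ℓ) {t : ℝ} (ht : 0 ≤ t) :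
    omegaSeq (assocSeq σ ℓ) t ≤ σ (max t 1) / ℓ := by
  refine csSup_le ⟨_, 0, rfl⟩ ?_
  rintro z ⟨p, rfl⟩
  exact log_pow_div_assocSeq_le hσ hℓ ht p

lemma assocSeq_zero {σ : ℝ → ℝ} (hσ : IsW0 σ) (ℓ : ℝ) : assocSeq σ ℓ 0 = 1 := by
  have : phiStar σ 0 = 0 := by
    refine le_antisymm (phiStar_le fun y _ => ?_) (phiStar_nonneg hσ 0)
    have := hσ.1.1 (Real.exp y)
    linarith
  simp [assocSeq, this]

lemma omegaSeq_nonneg {σ : ℝ → ℝ} (hσ : IsW0 σ) (ℓ t : ℝ) :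
    0 ≤ omegaSeq (assocSeq σ ℓ) t := by
  refine Real.sSup_nonneg' ⟨0, ⟨0, ?_⟩, le_rfl⟩
  simp [assocSeq_zero hσ]

lemma omegaSeq_zero {σ : ℝ → ℝ} (hσ : IsW0 σ) {ℓ : ℝ} (hℓ : 0 < ℓ) :
    omegaSeq (assocSeq σ ℓ) 0 = 0 := by
  refine le_antisymm ((omegaSeq_le hσ hℓ le_rfl).trans ?_) (omegaSeq_nonneg hσ ℓ 0)
  simp [hσ.2.2.1 1 ⟨zero_le_one, le_rfl⟩]

lemma le_omegaSeq {σ : ℝ → ℝ} (hσ : IsW0 σ) {ℓ : ℝ} (hℓ : 0 < ℓ) {t : ℝ} (ht : 1 ≤ t) :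
    σ t / ℓ - Real.log t ≤ omegaSeq (assocSeq σ ℓ) t := by
  have ht0 : 0 < t := by linarith
  have hmono : Monotone fun y : ℝ => σ (Real.exp y) := fun a b hab =>
    hσ.1.2.1 (Real.exp_pos a).le (Real.exp_pos b).le (Real.exp_le_exp.2 hab)
  obtain ⟨k, hk, hline⟩ := exists_supporting_line hσ.2.2.2.2 hmono (Real.log t)
  simp only [Real.exp_log ht0] at hline
  have hphi : phiStar σ k ≤ k * Real.log t - σ t := by
    refine phiStar_le fun y _ => ?_
    have := hline y
    linarith
  set p := ⌊k / ℓ⌋₊ with hp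
  have hp1 : ℓ * p ≤ k := by
    have := Nat.floor_le (div_nonneg hk hℓ.le)
    rw [le_div_iff₀ hℓ] at this
    linarith
  have hp2 : k / ℓ - 1 ≤ p := (Nat.sub_one_lt_floor (k / ℓ)).le
  have h1 : Real.log (t ^ p / assocSeq σ ℓ p) ≤ omegaSeq (assocSeq σ ℓ) t :=
    le_csSup (bddAbove_omegaSeq hσ hℓ ht0.le) ⟨p, rfl⟩
  rw [log_pow_div_assocSeq σ ℓ ht0] at h1
  refine le_trans ?_ h1
  have h2 := (phiStar_mono hσ hp1).trans hphi
  have h3 := mul_le_mul_of_nonneg_right hp2 (Real.log_nonneg ht)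
  have h4 : 1 / ℓ * phiStar σ (ℓ * p) ≤ 1 / ℓ * (k * Real.log t - σ t) :=
    mul_le_mul_of_nonneg_left h2 (by positivity)
  have h5 : 1 / ℓ * (k * Real.log t - σ t) = k / ℓ * Real.log t - σ t / ℓ := by ring
  linarith

lemma tendsto_omegaSeq_div {σ : ℝ → ℝ} (hσ : IsW0 σ) {ℓ : ℝ} (hℓ : 0 < ℓ) :
    Tendsto (fun t => omegaSeq (assocSeq σ ℓ) t / σ t) atTop (𝓝 (1 / ℓ)) := by
  have hlog : Tendsto (fun t => 1 / ℓ - Real.log t / σ t) atTop (𝓝 (1 / ℓ - 0)) :=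
    tendsto_const_nhds.sub hσ.2.2.2.1.tendsto_div_nhds_zero
  rw [sub_zero] at hlog
  have hev : ∀ᶠ t in atTop, 0 < σ t ∧ 1 ≤ t :=
    (hσ.1.2.2.eventually_gt_atTop 0).and (eventually_ge_atTop 1)
  refine tendsto_of_tendsto_of_tendsto_of_le_of_le' hlog tendsto_const_nhds ?_ ?_
  · filter_upwards [hev] with t ⟨h, h1⟩
    rw [le_div_iff₀ h]
    refine le_trans (le_of_eq ?_) (le_omegaSeq hσ hℓ h1)
    field_simp
  · filter_upwards [hev] with t ⟨h, h1⟩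
    have := omegaSeq_le hσ hℓ (zero_le_one.trans h1)
    rw [max_eq_left h1] at this
    rw [div_le_iff₀ h]
    refine this.trans (le_of_eq ?_)
    ring

lemma tendsto_atTop_of_tendsto_div {f g : ℝ → ℝ} {c : ℝ} (hc : 0 < c)
    (hg : Tendsto g atTop atTop) (h : Tendsto (fun t => f t / g t) atTop (𝓝 c)) :
    Tendsto f atTop atTop := by
  refine (h.pos_mul_atTop hc hg).congr' ?_
  filter_upwards [hg.eventually_ne_atTop 0] with t ht
  field_simp

lemma isWeightFct_omegaSeq {σ : ℝ → ℝ} (hσ : IsW0 σ) {ℓ : ℝ} (hℓ : 0 < ℓ) :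
    IsWeightFct (omegaSeq (assocSeq σ ℓ)) := by
  refine ⟨omegaSeq_nonneg hσ ℓ, ?_,
    tendsto_atTop_of_tendsto_div (by positivity) hσ.1.2.2 (tendsto_omegaSeq_div hσ hℓ)⟩
  intro s hs t ht hst
  rcases (mem_Ici.1 hs).eq_or_lt with rfl | hs
  · rw [omegaSeq_zero hσ hℓ]
    exact omegaSeq_nonneg hσ ℓ t
  · refine csSup_le ⟨_, 0, rfl⟩ ?_
    rintro z ⟨p, rfl⟩
    refine le_trans ?_ (le_csSup (bddAbove_omegaSeq hσ hℓ ht) ⟨p, rfl⟩)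
    have hM : 0 < assocSeq σ ℓ p := Real.exp_pos _
    exact Real.log_le_log (by positivity) (by gcongr)

lemma tendsto_omegaSeq_div_omegaSeq {σ : ℝ → ℝ} (hσ : IsW0 σ) {ℓ ℓ' : ℝ} (hℓ : 0 < ℓ)
    (hℓ' : 0 < ℓ') :
    Tendsto (fun t => omegaSeq (assocSeq σ ℓ) t / omegaSeq (assocSeq σ ℓ') t) atTop
      (𝓝 (1 / ℓ / (1 / ℓ'))) := by
  refine ((tendsto_omegaSeq_div hσ hℓ).div (tendsto_omegaSeq_div hσ hℓ')
    (by positivity)).congr' ?_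
  filter_upwards [hσ.1.2.2.eventually_ne_atTop 0] with t ht
  simp only [Pi.div_apply]
  rw [div_div_div_cancel_right₀ ht]

lemma exists_le_mul_add_of_tendsto_div {f g : ℝ → ℝ} (hf : IsWeightFct f) (hg : IsWeightFct g)
    {c : ℝ} (hc : 0 < c) (h : Tendsto (fun t => f t / g t) atTop (𝓝 c)) :
    ∃ A D : ℝ, 0 < A ∧ ∀ t, 0 ≤ t → f t ≤ A * g t + D := by
  have h1 : ∀ᶠ t in atTop, f t ≤ (c + 1) * g t := by
    filter_upwards [h.eventually (gt_mem_nhds (lt_add_one c)), hg.2.2.eventually_gt_atTop 0]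
      with t ht ht'
    exact ((div_lt_iff₀ ht').1 ht).le
  obtain ⟨T, hT⟩ := eventually_atTop.1 h1
  refine ⟨c + 1, f |T|, by linarith, fun t ht => ?_⟩
  rcases le_total T t with h | h
  · have := hT t h
    have := hf.1 |T|
    linarith
  · have := hf.2.1 (mem_Ici.2 ht) (abs_nonneg T) (h.trans (le_abs_self T))
    have := mul_nonneg (by linarith : 0 ≤ c + 1) (hg.1 t)
    linarith

lemma gammaProp_iff {ω : ℝ → ℝ} (hω : Tendsto ω atTop atTop) (g : ℝ) :
    gammaProp ω g ↔ ∃ K K' : ℝ, 1 < K ∧ 0 < K' ∧ K' < K ∧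
      ∀ᶠ t in atTop, ω (K ^ g * t) ≤ K' * ω t := by
  constructor
  · rintro ⟨K, hK, h⟩
    obtain ⟨x, hx1, hx2⟩ := EReal.lt_iff_exists_real_btwn.1 h
    refine ⟨K, max x (1 / 2), hK, by positivity,
      max_lt (EReal.coe_lt_coe_iff.1 hx2) (by linarith), ?_⟩
    filter_upwards [eventually_lt_of_limsup_lt hx1, hω.eventually_gt_atTop 0] with t ht ht0
    have := (div_lt_iff₀ ht0).1 (EReal.coe_lt_coe_iff.1 ht)
    exact this.le.trans (mul_le_mul_of_nonneg_right (le_max_left _ _) ht0.le)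
  · rintro ⟨K, K', hK, -, hK', h⟩
    refine ⟨K, hK, lt_of_le_of_lt (limsup_le_of_le (a := (K' : EReal)) ?_ ?_)
      (EReal.coe_lt_coe_iff.2 hK')⟩
    · isBoundedDefault
    · filter_upwards [h, hω.eventually_gt_atTop 0] with t ht ht0
      exact EReal.coe_le_coe_iff.2 ((div_le_iff₀ ht0).2 ht)

lemma gammaBarProp_iff {ω : ℝ → ℝ} (hω : Tendsto ω atTop atTop) (g : ℝ) :
    gammaBarProp ω g ↔ ∃ A A' : ℝ, 1 < A ∧ A < A' ∧
      ∀ᶠ t in atTop, A' * ω t ≤ ω (A ^ g * t) := by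
  constructor
  · rintro ⟨A, hA, h⟩
    obtain ⟨x, hx1, hx2⟩ := EReal.lt_iff_exists_real_btwn.1 h
    refine ⟨A, x, hA, EReal.coe_lt_coe_iff.1 hx1, ?_⟩
    filter_upwards [eventually_lt_of_lt_liminf hx2, hω.eventually_gt_atTop 0] with t ht ht0
    exact ((lt_div_iff₀ ht0).1 (EReal.coe_lt_coe_iff.1 ht)).le
  · rintro ⟨A, A', hA, hA', h⟩
    refine ⟨A, hA, lt_of_lt_of_le (EReal.coe_lt_coe_iff.2 hA')
      (le_liminf_of_le (a := (A' : EReal)) ?_ ?_)⟩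
    · isBoundedDefault
    · filter_upwards [h, hω.eventually_gt_atTop 0] with t ht ht0
      exact EReal.coe_le_coe_iff.2 ((le_div_iff₀ ht0).2 ht)

lemma tendsto_const_rpow_mul_atTop {K : ℝ} (hK : 0 < K) (g : ℝ) :
    Tendsto (fun t : ℝ => K ^ g * t) atTop atTop :=
  tendsto_id.const_mul_atTop (Real.rpow_pos_of_pos hK g)

lemma tendsto_ratio_ratio {f h : ℝ → ℝ} {c : ℝ} (hc : 0 < c)
    (hfh : Tendsto (fun t => f t / h t) atTop (𝓝 c)) {q : ℝ → ℝ} (hq : Tendsto q atTop atTop) :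
    Tendsto (fun t => (f (q t) / h (q t)) / (f t / h t)) atTop (𝓝 1) := by
  have := (hfh.comp hq).div hfh hc.ne'
  rwa [div_self hc.ne'] at this

lemma gammaProp_of_tendsto_div {f h : ℝ → ℝ} {c : ℝ} (hc : 0 < c)
    (hh : Tendsto h atTop atTop)
    (hfh : Tendsto (fun t => f t / h t) atTop (𝓝 c)) {g : ℝ} (H : gammaProp h g) :
    gammaProp f g := by
  have hf := tendsto_atTop_of_tendsto_div hc hh hfh
  obtain ⟨K, K', hK, hK'0, hK', hev⟩ := (gammaProp_iff hh g).1 H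
  have hq := tendsto_const_rpow_mul_atTop (zero_lt_one.trans hK) g
  obtain ⟨L, hL1, hL2⟩ := exists_between hK'
  refine (gammaProp_iff hf g).2 ⟨K, L, hK, hK'0.trans hL1, hL2, ?_⟩
  have h1 : 1 < L / K' := (one_lt_div hK'0).2 hL1
  filter_upwards [hev, (tendsto_ratio_ratio hc hfh hq).eventually (gt_mem_nhds h1),
    hh.eventually_gt_atTop 0, hf.eventually_gt_atTop 0, hq.eventually (hh.eventually_gt_atTop 0)]
    with t h2 h3 h4 h5 h6
  rw [div_lt_iff₀ (by positivity), div_lt_iff₀ h6] at h3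
  refine h3.le.trans ?_
  calc L / K' * (f t / h t) * h (K ^ g * t) ≤ L / K' * (f t / h t) * (K' * h t) := by
        have : 0 < L := hK'0.trans hL1
        gcongr
    _ = L * f t := by field_simp

lemma gammaBarProp_of_tendsto_div {f h : ℝ → ℝ} {c : ℝ} (hc : 0 < c)
    (hh : Tendsto h atTop atTop)
    (hfh : Tendsto (fun t => f t / h t) atTop (𝓝 c)) {g : ℝ} (H : gammaBarProp h g) :
    gammaBarProp f g := by
  have hf := tendsto_atTop_of_tendsto_div hc hh hfh
  obtain ⟨A, A', hA, hA', hev⟩ := (gammaBarProp_iff hh g).1 H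
  have hA0 := zero_lt_one.trans hA
  have hA'0 := hA0.trans hA'
  have hq := tendsto_const_rpow_mul_atTop hA0 g
  obtain ⟨L, hL1, hL2⟩ := exists_between hA'
  refine (gammaBarProp_iff hf g).2 ⟨A, L, hA, hL1, ?_⟩
  have h1 : L / A' < 1 := (div_lt_one hA'0).2 hL2
  filter_upwards [hev, (tendsto_ratio_ratio hc hfh hq).eventually (lt_mem_nhds h1),
    hh.eventually_gt_atTop 0, hf.eventually_gt_atTop 0, hq.eventually (hh.eventually_gt_atTop 0)]
    with t h2 h3 h4 h5 h6
  rw [lt_div_iff₀ (by positivity), lt_div_iff₀ h6] at h3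
  refine le_trans ?_ h3.le
  calc L * f t = L / A' * (f t / h t) * (A' * h t) := by field_simp
    _ ≤ L / A' * (f t / h t) * h (A ^ g * t) := by
        have : 0 < L := hA0.trans hL1
        gcongr

lemma tendsto_div_inv {f h : ℝ → ℝ} {c : ℝ} (hc : 0 < c)
    (hfh : Tendsto (fun t => f t / h t) atTop (𝓝 c)) :
    Tendsto (fun t => h t / f t) atTop (𝓝 c⁻¹) := by
  simpa using hfh.inv₀ hc.ne'

lemma gammaIdx_eq_of_tendsto_div {f h : ℝ → ℝ} {c : ℝ} (hc : 0 < c)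
    (hh : Tendsto h atTop atTop) (hfh : Tendsto (fun t => f t / h t) atTop (𝓝 c)) :
    gammaIdx f = gammaIdx h := by
  have hf := tendsto_atTop_of_tendsto_div hc hh hfh
  have (g : ℝ) : gammaProp f g ↔ gammaProp h g :=
    ⟨gammaProp_of_tendsto_div (inv_pos.2 hc) hf (tendsto_div_inv hc hfh),
      gammaProp_of_tendsto_div hc hh hfh⟩
  simp only [gammaIdx, this]

lemma gammaBarIdx_eq_of_tendsto_div {f h : ℝ → ℝ} {c : ℝ} (hc : 0 < c)
    (hh : Tendsto h atTop atTop) (hfh : Tendsto (fun t => f t / h t) atTop (𝓝 c)) :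
    gammaBarIdx f = gammaBarIdx h := by
  have hf := tendsto_atTop_of_tendsto_div hc hh hfh
  have (g : ℝ) : gammaBarProp f g ↔ gammaBarProp h g :=
    ⟨gammaBarProp_of_tendsto_div (inv_pos.2 hc) hf (tendsto_div_inv hc hfh),
      gammaBarProp_of_tendsto_div hc hh hfh⟩
  simp only [gammaBarIdx, this]

lemma gammaIdx_omegaSeq {σ : ℝ → ℝ} (hσ : IsW0 σ) {ℓ : ℝ} (hℓ : 0 < ℓ) :
    gammaIdx (omegaSeq (assocSeq σ ℓ)) = gammaIdx σ :=
  gammaIdx_eq_of_tendsto_div (by positivity) hσ.1.2.2 (tendsto_omegaSeq_div hσ hℓ)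

lemma gammaBarIdx_omegaSeq {σ : ℝ → ℝ} (hσ : IsW0 σ) {ℓ : ℝ} (hℓ : 0 < ℓ) :
    gammaBarIdx (omegaSeq (assocSeq σ ℓ)) = gammaBarIdx σ :=
  gammaBarIdx_eq_of_tendsto_div (by positivity) hσ.1.2.2 (tendsto_omegaSeq_div hσ hℓ)

lemma exists_le_rpow_mul {ω : ℝ → ℝ} (hω : IsWeightFct ω) {g : ℝ} (hg : 0 < g)
    (h : gammaProp ω g) : ∃ a C t₀ : ℝ, 0 < a ∧ a * g < 1 ∧ 0 < C ∧ 0 < t₀ ∧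
      ∀ t, t₀ ≤ t → ∀ l, 1 ≤ l → ω (l * t) ≤ C * l ^ a * ω t := by
  obtain ⟨K, K', hK, -, hK', hev⟩ := (gammaProp_iff hω.2.2 g).1 h
  obtain ⟨T, hT⟩ := eventually_atTop.1 hev
  obtain ⟨L, hL1, hL2⟩ := exists_between (max_lt hK hK')
  rw [max_lt_iff] at hL1
  obtain ⟨hL1, hLK⟩ := hL1
  have hL0 : 0 < L := zero_lt_one.trans hL1
  have hK0 : 0 < K := zero_lt_one.trans hK
  have hlogK := Real.log_pos hK
  have hlogL := Real.log_pos hL1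
  have hq1 : 1 < K ^ g := Real.one_lt_rpow hK hg
  have hq0 : 0 < K ^ g := zero_lt_one.trans hq1
  have hiter : ∀ n : ℕ, ∀ t, max T 1 ≤ t → ω ((K ^ g) ^ n * t) ≤ L ^ n * ω t := by
    intro n t ht
    have ht0 : 0 < t := zero_lt_one.trans_le ((le_max_right _ _).trans ht)
    induction n with
    | zero => simp
    | succ n ih =>
      have h1 : T ≤ (K ^ g) ^ n * t := by
        have := le_mul_of_one_le_left ht0.le (one_le_pow₀ (n := n) hq1.le)
        exact ((le_max_left _ _).trans ht).trans this
      have h2 := hT _ h1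
      rw [← mul_assoc, ← pow_succ'] at h2
      calc ω ((K ^ g) ^ (n + 1) * t) ≤ K' * ω ((K ^ g) ^ n * t) := h2
        _ ≤ L * ω ((K ^ g) ^ n * t) := mul_le_mul_of_nonneg_right hLK.le (hω.1 _)
        _ ≤ L * (L ^ n * ω t) := mul_le_mul_of_nonneg_left ih hL0.le
        _ = L ^ (n + 1) * ω t := by ring
  refine ⟨Real.log L / Real.log (K ^ g), L, max T 1, div_pos hlogL (Real.log_pos hq1), ?_,
    hL0, by positivity, ?_⟩
  · rw [Real.log_rpow hK0, div_mul_eq_mul_div, div_lt_one (by positivity), mul_comm]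
    exact mul_lt_mul_of_pos_left (Real.log_lt_log hL0 hL2) hg
  · intro t ht l hl
    have hl0 : 0 < l := zero_lt_one.trans_le hl
    have ht0 : 0 < t := zero_lt_one.trans_le ((le_max_right _ _).trans ht)
    have hlogq := Real.log_pos hq1
    set x := Real.log l / Real.log (K ^ g) with hx
    have hx0 : 0 ≤ x := div_nonneg (Real.log_nonneg hl) hlogq.le
    have hle : l ≤ (K ^ g) ^ ⌈x⌉₊ := by
      rw [← Real.log_le_log_iff hl0 (by positivity), Real.log_pow, ← div_le_iff₀ hlogq]
      exact Nat.le_ceil x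
    have hpow : L ^ ⌈x⌉₊ ≤ L * l ^ (Real.log L / Real.log (K ^ g)) := by
      rw [← Real.log_le_log_iff (by positivity) (by positivity), Real.log_pow,
        Real.log_mul hL0.ne' (by positivity), Real.log_rpow hl0]
      have h1 := mul_le_mul_of_nonneg_right (Nat.ceil_lt_add_one hx0).le hlogL.le
      refine h1.trans (le_of_eq ?_)
      rw [hx]
      ring
    calc ω (l * t) ≤ ω ((K ^ g) ^ ⌈x⌉₊ * t) :=
          hω.2.1 (mem_Ici.2 (by positivity)) (mem_Ici.2 (by positivity))
            (mul_le_mul_of_nonneg_right hle ht0.le)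
      _ ≤ L ^ ⌈x⌉₊ * ω t := hiter _ t ht
      _ ≤ _ := mul_le_mul_of_nonneg_right hpow (hω.1 t)

lemma exists_rpow_mul_le {ω : ℝ → ℝ} (hω : IsWeightFct ω) {g : ℝ} (hg : 0 < g)
    (h : gammaBarProp ω g) : ∃ a c t₀ : ℝ, 0 < a ∧ 1 < a * g ∧ 0 < c ∧ 0 < t₀ ∧ 0 < ω t₀ ∧
      ∀ t, t₀ ≤ t → ∀ l, 1 ≤ l → c * l ^ a * ω t ≤ ω (l * t) := by
  obtain ⟨K, L, hK, hKL, hev⟩ := (gammaBarProp_iff hω.2.2 g).1 h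
  obtain ⟨T, hT⟩ := eventually_atTop.1
    (hev.and ((eventually_ge_atTop 1).and (hω.2.2.eventually_gt_atTop 0)))
  have hT1 : 1 ≤ T := (hT T le_rfl).2.1
  have hK0 : 0 < K := zero_lt_one.trans hK
  have hL1 : 1 < L := hK.trans hKL
  have hL0 : 0 < L := zero_lt_one.trans hL1
  have hlogK := Real.log_pos hK
  have hlogL := Real.log_pos hL1
  have hq1 : 1 < K ^ g := Real.one_lt_rpow hK hg
  have hq0 : 0 < K ^ g := zero_lt_one.trans hq1
  have hiter : ∀ n : ℕ, ∀ t, T ≤ t → L ^ n * ω t ≤ ω ((K ^ g) ^ n * t) := by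
    intro n t ht
    have ht0 : 0 < t := zero_lt_one.trans_le (hT1.trans ht)
    induction n with
    | zero => simp
    | succ n ih =>
      have h1 : T ≤ (K ^ g) ^ n * t :=
        ht.trans (le_mul_of_one_le_left ht0.le (one_le_pow₀ (n := n) hq1.le))
      have h2 := (hT _ h1).1
      rw [← mul_assoc, ← pow_succ'] at h2
      calc L ^ (n + 1) * ω t = L * (L ^ n * ω t) := by ring
        _ ≤ L * ω ((K ^ g) ^ n * t) := mul_le_mul_of_nonneg_left ih hL0.le
        _ ≤ _ := h2
  refine ⟨Real.log L / Real.log (K ^ g), L⁻¹, T, div_pos hlogL (Real.log_pos hq1), ?_,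
    by positivity, by positivity, (hT T le_rfl).2.2, ?_⟩
  · rw [Real.log_rpow hK0, div_mul_eq_mul_div, one_lt_div (by positivity), mul_comm (Real.log L)]
    exact mul_lt_mul_of_pos_left (Real.log_lt_log hK0 hKL) hg
  · intro t ht l hl
    have hl0 : 0 < l := zero_lt_one.trans_le hl
    have ht0 : 0 < t := zero_lt_one.trans_le (hT1.trans ht)
    have hlogq := Real.log_pos hq1
    set x := Real.log l / Real.log (K ^ g) with hx
    have hx0 : 0 ≤ x := div_nonneg (Real.log_nonneg hl) hlogq.le
    have hle : (K ^ g) ^ ⌊x⌋₊ ≤ l := by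
      rw [← Real.log_le_log_iff (by positivity) hl0, Real.log_pow, ← le_div_iff₀ hlogq]
      exact Nat.floor_le hx0
    have hpow : L⁻¹ * l ^ (Real.log L / Real.log (K ^ g)) ≤ L ^ ⌊x⌋₊ := by
      rw [← Real.log_le_log_iff (by positivity) (by positivity), Real.log_pow,
        Real.log_mul (by positivity) (by positivity), Real.log_rpow hl0, Real.log_inv]
      have h1 := mul_le_mul_of_nonneg_right (Nat.sub_one_lt_floor x).le hlogL.le
      refine le_trans (le_of_eq ?_) h1
      rw [hx]
      ring
    calc _ ≤ L ^ ⌊x⌋₊ * ω t := mul_le_mul_of_nonneg_right hpow (hω.1 t)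
      _ ≤ ω ((K ^ g) ^ ⌊x⌋₊ * t) := hiter _ t ht
      _ ≤ ω (l * t) := hω.2.1 (mem_Ici.2 (by positivity)) (mem_Ici.2 (by positivity))
            (mul_le_mul_of_nonneg_right hle ht0.le)

lemma eventually_scaling_le {ω : ℝ → ℝ} (hω : IsWeightFct ω) {g : ℝ} (hg : 0 < g)
    (h : gammaProp ω g) {ε : ℝ} (hε : 0 < ε) :
    ∀ᶠ K : ℝ in atTop, ∃ D, ∀ u, 0 ≤ u → ω (K ^ g * u) ≤ ε * K * ω u + D := by
  obtain ⟨a, C, t₀, ha, hag, hC, ht₀, H⟩ := exists_le_rpow_mul hω hg h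
  have hlim := (tendsto_rpow_atTop (sub_pos.2 hag)).eventually_ge_atTop (C / ε)
  filter_upwards [hlim, eventually_ge_atTop 1] with K hK hK1
  have hK0 : 0 < K := zero_lt_one.trans_le hK1
  have hg1 : 1 ≤ K ^ g := Real.one_le_rpow hK1 hg.le
  refine ⟨ω (K ^ g * t₀), fun u hu => ?_⟩
  rcases le_total t₀ u with h1 | h1
  · refine (H u h1 _ hg1).trans ?_
    have h2 : C * (K ^ g) ^ a ≤ ε * K := by
      rw [← Real.rpow_mul hK0.le, mul_comm g a]
      calc C * K ^ (a * g) ≤ (ε * K ^ (1 - a * g)) * K ^ (a * g) := by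
            gcongr
            rwa [div_le_iff₀' hε] at hK
        _ = ε * K := by
            rw [mul_assoc, ← Real.rpow_add hK0]
            simp
    have h3 := mul_le_mul_of_nonneg_right h2 (hω.1 u)
    have := hω.1 (K ^ g * t₀)
    linarith
  · have h2 := hω.2.1 (mem_Ici.2 (by positivity)) (mem_Ici.2 (by positivity))
      (mul_le_mul_of_nonneg_left h1 (zero_le_one.trans hg1))
    have : 0 ≤ ε * K * ω u := mul_nonneg (by positivity) (hω.1 u)
    linarith

lemma eventually_le_scaling {ω : ℝ → ℝ} (hω : IsWeightFct ω) {g : ℝ} (hg : 0 < g)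
    (h : gammaBarProp ω g) {M : ℝ} (hM : 0 < M) :
    ∀ᶠ K : ℝ in atTop, ∃ D, ∀ u, 0 ≤ u → M * K * ω u ≤ ω (K ^ g * u) + D := by
  obtain ⟨a, c, t₀, ha, hag, hc, ht₀, -, H⟩ := exists_rpow_mul_le hω hg h
  have hlim := (tendsto_rpow_atTop (sub_pos.2 hag)).eventually_ge_atTop (M / c)
  filter_upwards [hlim, eventually_ge_atTop 1] with K hK hK1
  have hK0 : 0 < K := zero_lt_one.trans_le hK1
  have hg1 : 1 ≤ K ^ g := Real.one_le_rpow hK1 hg.le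
  have hD : 0 ≤ M * K * ω t₀ := mul_nonneg (by positivity) (hω.1 _)
  refine ⟨M * K * ω t₀, fun u hu => ?_⟩
  rcases le_total t₀ u with h1 | h1
  · refine le_trans ?_ (le_add_of_le_of_nonneg (H u h1 _ hg1) hD)
    refine mul_le_mul_of_nonneg_right ?_ (hω.1 u)
    rw [← Real.rpow_mul hK0.le, mul_comm g a]
    calc M * K = M * K ^ (1 : ℝ) := by simp
      _ ≤ (c * K ^ (a * g - 1)) * K ^ (1 : ℝ) := by
            gcongr
            rwa [div_le_iff₀' hc] at hK
      _ = c * K ^ (a * g) := by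
            rw [mul_assoc, ← Real.rpow_add hK0]
            simp
  · have h2 := hω.2.1 (mem_Ici.2 hu) (mem_Ici.2 ht₀.le) h1
    have := mul_le_mul_of_nonneg_left h2 (by positivity : 0 ≤ M * K)
    have := hω.1 (K ^ g * u)
    linarith

lemma exists_le_rpow_add {ω : ℝ → ℝ} (hω : IsWeightFct ω) {g : ℝ} (hg : 0 < g)
    (h : gammaProp ω g) : ∃ a C D : ℝ, 0 < a ∧ a * g < 1 ∧
      ∀ s, 0 ≤ s → ω s ≤ C * s ^ a + D := by
  obtain ⟨a, C, t₀, ha, hag, hC, ht₀, H⟩ := exists_le_rpow_mul hω hg h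
  have hw := hω.1 t₀
  refine ⟨a, C * (t₀ ^ a)⁻¹ * ω t₀, ω t₀, ha, hag, fun s hs => ?_⟩
  rcases le_total t₀ s with h1 | h1
  · have h2 := H t₀ le_rfl (s / t₀) ((one_le_div ht₀).2 h1)
    rw [div_mul_cancel₀ _ ht₀.ne', Real.div_rpow hs ht₀.le] at h2
    have : C * (s ^ a / t₀ ^ a) * ω t₀ = C * (t₀ ^ a)⁻¹ * ω t₀ * s ^ a := by ring
    linarith
  · have h2 := hω.2.1 (mem_Ici.2 hs) (mem_Ici.2 ht₀.le) h1
    have : 0 ≤ C * (t₀ ^ a)⁻¹ * ω t₀ * s ^ a := by positivity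
    linarith

lemma exists_rpow_le_add {ω : ℝ → ℝ} (hω : IsWeightFct ω) {g : ℝ} (hg : 0 < g)
    (h : gammaBarProp ω g) : ∃ a c D : ℝ, 0 < a ∧ 1 < a * g ∧ 0 < c ∧
      ∀ s, 0 ≤ s → c * s ^ a ≤ ω s + D := by
  obtain ⟨a, c, t₀, ha, hag, hc, ht₀, hw, H⟩ := exists_rpow_mul_le hω hg h
  refine ⟨a, c * (t₀ ^ a)⁻¹ * ω t₀, c * (t₀ ^ a)⁻¹ * ω t₀ * t₀ ^ a, ha, hag, by positivity,
    fun s hs => ?_⟩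
  rcases le_total t₀ s with h1 | h1
  · have h2 := H t₀ le_rfl (s / t₀) ((one_le_div ht₀).2 h1)
    rw [div_mul_cancel₀ _ ht₀.ne', Real.div_rpow hs ht₀.le] at h2
    have : c * (s ^ a / t₀ ^ a) * ω t₀ = c * (t₀ ^ a)⁻¹ * ω t₀ * s ^ a := by ring
    have : 0 ≤ c * (t₀ ^ a)⁻¹ * ω t₀ * t₀ ^ a := by positivity
    linarith
  · have h2 := Real.rpow_le_rpow hs h1 ha.le
    have := mul_le_mul_of_nonneg_left h2 (by positivity : 0 ≤ c * (t₀ ^ a)⁻¹ * ω t₀)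
    have := hω.1 s
    linarith

lemma eventually_rpow_add_lt {a b c : ℝ} (hab : a < b) (hb : 0 < b) (hc : 0 < c) (E F : ℝ) :
    ∀ᶠ t : ℝ in atTop, E * t ^ a + F < c * t ^ b := by
  have h1 : Tendsto (fun t : ℝ => c - E * t ^ (-(b - a))) atTop (𝓝 (c - E * 0)) :=
    tendsto_const_nhds.sub ((tendsto_rpow_neg_atTop (sub_pos.2 hab)).const_mul E)
  rw [mul_zero, sub_zero] at h1
  filter_upwards [(h1.pos_mul_atTop hc (tendsto_rpow_atTop hb)).eventually_gt_atTop F,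
    eventually_gt_atTop 0] with t ht ht0
  have : t ^ a = t ^ (-(b - a)) * t ^ b := by
    rw [← Real.rpow_add ht0]
    congr 1
    ring
  rw [this]
  linarith

lemma gammaIdx_le_gammaBarIdx_of_le {h h' : ℝ → ℝ} (hh : IsWeightFct h) (hh' : IsWeightFct h')
    {A B D : ℝ} (hA : 0 < A) (hB : 0 < B) (H : ∀ t, 0 < t → h' t ≤ A * h (B * t) + D) :
    gammaIdx h ≤ gammaBarIdx h' := by
  refine iSup₂_le fun g hg => le_sInf ?_
  rintro _ ⟨g', hg', rfl⟩
  refine ENNReal.ofReal_le_ofReal (not_lt.1 fun hlt => ?_)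
  obtain ⟨a, C, E, ha, hag, h1⟩ := exists_le_rpow_add hh hg.1 hg.2
  obtain ⟨b, c, F, hb, hbg, hc, h2⟩ := exists_rpow_le_add hh' hg'.1 hg'.2
  have hab : a < b := by
    by_contra! hba
    have := mul_le_mul hba hlt.le hg'.1.le ha.le
    linarith
  obtain ⟨t, ht, ht0⟩ := ((eventually_rpow_add_lt hab hb hc (A * (C * B ^ a))
    (A * E + D + F)).and (eventually_gt_atTop 0)).exists
  have h3 := h1 (B * t) (by positivity)
  rw [Real.mul_rpow hB.le ht0.le] at h3
  have h4 := mul_le_mul_of_nonneg_left h3 hA.le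
  have h5 := h2 t ht0.le
  have h6 := H t ht0
  have : A * (C * (B ^ a * t ^ a) + E) = A * (C * B ^ a) * t ^ a + A * E := by ring
  linarith

lemma gammaIdx_le_gammaBarIdx {ω : ℝ → ℝ} (hω : IsWeightFct ω) :
    gammaIdx ω ≤ gammaBarIdx ω :=
  gammaIdx_le_gammaBarIdx_of_le hω hω one_pos one_pos (D := 0) fun t _ => by simp

lemma upperConjWD_of_lt {σ τ : ℝ → ℝ} (hσ : IsWeightFct σ) (hτ : IsWeightFct τ) {g b : ℝ}
    (hb : 0 < b) (hbg : b < g) (hg : gammaProp σ g) (hb' : gammaBarProp τ b) :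
    UpperConjWD σ τ := by
  intro t ht
  obtain ⟨a, C, E, ha, hag, h1⟩ := exists_le_rpow_add hσ (hb.trans hbg) hg
  obtain ⟨d, c, F, hd, hdb, hc, h2⟩ := exists_rpow_le_add hτ hb hb'
  have had : a < d := by
    by_contra! hda
    have := mul_le_mul hda hbg.le hb.le ha.le
    linarith
  obtain ⟨S, hS⟩ := eventually_atTop.1
    (eventually_rpow_add_lt had hd (div_pos hc (Real.rpow_pos_of_pos ht d)) C 0)
  have hσS := hσ.1 |S|
  refine ⟨max (σ |S|) (E + F), ?_⟩
  rintro z ⟨s, hs, rfl⟩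
  rcases le_total S s with h | h
  · have h3 := h1 s hs
    have h4 := h2 (s / t) (by positivity)
    have h5 := hS s h
    rw [Real.div_rpow hs ht.le] at h4
    have : c / t ^ d * s ^ d = c * (s ^ d / t ^ d) := by ring
    exact le_max_of_le_right (by linarith)
  · have h3 := hσ.2.1 (mem_Ici.2 hs) (abs_nonneg S) (h.trans (le_abs_self S))
    have := hτ.1 (s / t)
    exact le_max_of_le_left (by linarith)

lemma upperConjWD_of_gammaBarIdx_lt {σ τ : ℝ → ℝ} (hσ : IsWeightFct σ) (hτ : IsWeightFct τ)
    (h : gammaBarIdx τ < gammaIdx σ) : UpperConjWD σ τ := by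
  obtain ⟨g, hg⟩ := lt_iSup_iff.1 h
  obtain ⟨hg', hlt⟩ := lt_iSup_iff.1 hg
  obtain ⟨_, ⟨b, hb, rfl⟩, hbg⟩ := sInf_lt_iff.1 hlt
  exact upperConjWD_of_lt hσ hτ hb.1 ((ENNReal.ofReal_lt_ofReal_iff hg'.1).1 hbg) hg'.2 hb.2

lemma le_upperConj {σ τ : ℝ → ℝ} (h : UpperConjWD σ τ) {s t : ℝ} (ht : 0 < t) (hs : 0 ≤ s) :
    σ s - τ (s / t) ≤ upperConj σ τ t := by
  rw [upperConj, if_neg ht.ne']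
  exact le_csSup (h t ht) ⟨s, hs, rfl⟩

lemma upperConj_le {σ τ : ℝ → ℝ} {t c : ℝ} (ht : 0 < t)
    (h : ∀ s, 0 ≤ s → σ s - τ (s / t) ≤ c) : upperConj σ τ t ≤ c := by
  rw [upperConj, if_neg ht.ne']
  refine csSup_le ⟨_, 0, le_rfl, rfl⟩ ?_
  rintro z ⟨s, hs, rfl⟩
  exact h s hs

lemma tendsto_upperConj {σ τ : ℝ → ℝ} (hσ : IsWeightFct σ) (h : UpperConjWD σ τ) :
    Tendsto (upperConj σ τ) atTop atTop := by
  refine tendsto_atTop_mono' _ ?_ (tendsto_atTop_add_const_right atTop (-τ 1) hσ.2.2)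
  filter_upwards [eventually_gt_atTop 0] with t ht
  have := le_upperConj h ht ht.le
  rwa [div_self ht.ne'] at this

lemma isWeightFct_upperConj {σ τ : ℝ → ℝ} (hσ : IsWeightFct σ) (hτ : IsWeightFct τ)
    (hτ0 : τ 0 = 0) (h : UpperConjWD σ τ) : IsWeightFct (upperConj σ τ) := by
  have h0 : upperConj σ τ 0 = σ 0 := by simp [upperConj, hτ0]
  have hle : ∀ t, 0 < t → σ 0 ≤ upperConj σ τ t := fun t ht => by
    have := le_upperConj h ht le_rfl
    rwa [zero_div, hτ0, sub_zero] at this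
  refine ⟨fun t => ?_, ?_, tendsto_upperConj hσ h⟩
  · by_cases ht : t = 0
    · rw [ht, h0]
      exact hσ.1 0
    · rw [upperConj, if_neg ht]
      refine Real.sSup_nonneg' ⟨_, ⟨0, le_rfl, rfl⟩, ?_⟩
      rw [zero_div, hτ0, sub_zero]
      exact hσ.1 0
  · intro s hs t ht hst
    rcases (mem_Ici.1 hs).eq_or_lt with rfl | hs
    · rcases (mem_Ici.1 ht).eq_or_lt with rfl | ht
      · exact le_rfl
      · rw [h0]
        exact hle t ht
    · have ht' : 0 < t := hs.trans_le hst
      refine upperConj_le hs fun u hu => le_trans ?_ (le_upperConj h ht' hu)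
      refine sub_le_sub_left (hτ.2.1 (mem_Ici.2 (by positivity)) (mem_Ici.2 (by positivity)) ?_) _
      exact div_le_div_of_nonneg_left hu hs hst

lemma gammaProp_upperConj {σ τ : ℝ → ℝ} (hσ : IsWeightFct σ) (hτ : IsWeightFct τ) {g b : ℝ}
    (hb : 0 < b) (hbg : b < g) (hg : gammaProp σ g) (hb' : gammaBarProp τ b) :
    gammaProp (upperConj σ τ) (g - b) := by
  have hwd := upperConjWD_of_lt hσ hτ hb hbg hg hb'
  have hlim := tendsto_upperConj hσ hwd
  obtain ⟨K, ⟨⟨D, hD⟩, ⟨E, hE⟩⟩, hK⟩ :=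
    (((eventually_scaling_le hσ (hb.trans hbg) hg (by norm_num : (0:ℝ) < 1 / 3)).and
      (eventually_le_scaling hτ hb hb' (by norm_num : (0:ℝ) < 1 / 3))).and
      (eventually_gt_atTop 1)).exists
  have hK0 : 0 < K := zero_lt_one.trans hK
  refine (gammaProp_iff hlim _).2 ⟨K, 2 / 3 * K, hK, by positivity, by linarith, ?_⟩
  filter_upwards [eventually_gt_atTop 0,
    (hlim.const_mul_atTop (by positivity : 0 < 1 / 3 * K)).eventually_ge_atTop (D + E)]
    with t ht hlarge
  have hgb := Real.rpow_pos_of_pos hK0 (g - b)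
  have hgp := Real.rpow_pos_of_pos hK0 g
  have hbp := Real.rpow_pos_of_pos hK0 b
  refine upperConj_le (mul_pos hgb ht) fun s hs => ?_
  have h1 := hD (s / K ^ g) (by positivity)
  have h2 := hE (s / K ^ g / t) (by positivity)
  have h3 := mul_le_mul_of_nonneg_left
    (le_upperConj hwd ht (by positivity : 0 ≤ s / K ^ g)) (by positivity : 0 ≤ 1 / 3 * K)
  have e1 : K ^ g * (s / K ^ g) = s := by field_simp
  have e2 : K ^ b * (s / K ^ g / t) = s / (K ^ (g - b) * t) := by
    rw [Real.rpow_sub hK0]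
    field_simp
  rw [e1] at h1
  rw [e2] at h2
  linarith

lemma gammaBarProp_upperConj {σ τ : ℝ → ℝ} (hσ : IsWeightFct σ) (hτ : IsWeightFct τ) {g b : ℝ}
    (hb : 0 < b) (hbg : b < g) (hg : gammaBarProp σ g) (hb' : gammaProp τ b)
    (hwd : UpperConjWD σ τ) : gammaBarProp (upperConj σ τ) (g - b) := by
  have hlim := tendsto_upperConj hσ hwd
  obtain ⟨K, ⟨⟨D, hD⟩, ⟨E, hE⟩⟩, hK⟩ :=
    (((eventually_le_scaling hσ (hb.trans hbg) hg (by norm_num : (0:ℝ) < 3)).and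
      (eventually_scaling_le hτ hb hb' (by norm_num : (0:ℝ) < 3))).and
      (eventually_gt_atTop 1)).exists
  have hK0 : 0 < K := zero_lt_one.trans hK
  refine (gammaBarProp_iff hlim _).2 ⟨K, 2 * K, hK, by linarith, ?_⟩
  filter_upwards [eventually_gt_atTop 0,
    (hlim.const_mul_atTop hK0).eventually_ge_atTop (D + E)] with t ht hlarge
  have hgb := Real.rpow_pos_of_pos hK0 (g - b)
  have hgp := Real.rpow_pos_of_pos hK0 g
  have key : upperConj σ τ t ≤ (upperConj σ τ (K ^ (g - b) * t) + (D + E)) / (3 * K) := by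
    refine upperConj_le ht fun s hs => ?_
    rw [le_div_iff₀ (by positivity)]
    have h1 := hD s hs
    have h2 := hE (s / t) (by positivity)
    have h3 := le_upperConj hwd (mul_pos hgb ht) (by positivity : 0 ≤ K ^ g * s)
    have e2 : K ^ g * s / (K ^ (g - b) * t) = K ^ b * (s / t) := by
      rw [Real.rpow_sub hK0]
      field_simp
    rw [e2] at h3
    linarith
  rw [le_div_iff₀ (by positivity)] at key
  linarith

lemma gammaIdx_le_gammaIdx_upperConj_add {σ τ : ℝ → ℝ} (hσ : IsWeightFct σ)
    (hτ : IsWeightFct τ) : gammaIdx σ ≤ gammaIdx (upperConj σ τ) + gammaBarIdx τ := by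
  rw [gammaBarIdx, ENNReal.add_sInf]
  refine iSup₂_le fun g hg => le_iInf₂ ?_
  rintro _ ⟨b, hb, rfl⟩
  rcases le_or_gt g b with h | h
  · exact (ENNReal.ofReal_le_ofReal h).trans le_add_self
  · have h1 : ENNReal.ofReal (g - b) ≤ gammaIdx (upperConj σ τ) :=
      le_iSup₂_of_le (g - b) ⟨sub_pos.2 h, gammaProp_upperConj hσ hτ hb.1 h hg.2 hb.2⟩ le_rfl
    calc ENNReal.ofReal g = ENNReal.ofReal (g - b) + ENNReal.ofReal b := by
          rw [← ENNReal.ofReal_add (sub_pos.2 h).le hb.1.le, sub_add_cancel]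
      _ ≤ _ := by gcongr

lemma gammaBarIdx_upperConj_add_le {σ τ : ℝ → ℝ} (hσ : IsWeightFct σ) (hτ : IsWeightFct τ)
    (hpos : 0 < gammaIdx τ) (hlt : gammaBarIdx τ < gammaIdx σ) :
    gammaBarIdx (upperConj σ τ) + gammaIdx τ ≤ gammaBarIdx σ := by
  have hwd := upperConjWD_of_gammaBarIdx_lt hσ hτ hlt
  refine le_sInf ?_
  rintro _ ⟨g, hg, rfl⟩
  have hτg : gammaIdx τ < ENNReal.ofReal g :=
    ((gammaIdx_le_gammaBarIdx hτ).trans_lt hlt).trans_le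
      ((gammaIdx_le_gammaBarIdx hσ).trans (sInf_le ⟨g, hg, rfl⟩))
  have key : ∀ b, 0 < b ∧ gammaProp τ b →
      gammaBarIdx (upperConj σ τ) + ENNReal.ofReal b ≤ ENNReal.ofReal g := by
    intro b hb
    have hbg : b < g := (ENNReal.ofReal_lt_ofReal_iff hg.1).1
      ((le_iSup₂_of_le (f := fun (b : ℝ) (_ : 0 < b ∧ gammaProp τ b) => ENNReal.ofReal b)
        b hb le_rfl).trans_lt hτg)
    have h1 : gammaBarIdx (upperConj σ τ) ≤ ENNReal.ofReal (g - b) :=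
      sInf_le ⟨g - b, ⟨sub_pos.2 hbg,
        gammaBarProp_upperConj hσ hτ hb.1 hbg hg.2 hb.2 hwd⟩, rfl⟩
    calc _ ≤ ENNReal.ofReal (g - b) + ENNReal.ofReal b := by gcongr
      _ = ENNReal.ofReal g := by
          rw [← ENNReal.ofReal_add (sub_pos.2 hbg).le hb.1.le, sub_add_cancel]
  obtain ⟨b, hb⟩ := lt_iSup_iff.1 hpos
  obtain ⟨hb, -⟩ := lt_iSup_iff.1 hb
  have hle : gammaBarIdx (upperConj σ τ) ≤ ENNReal.ofReal g := le_self_add.trans (key b hb)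
  have hfin := ne_top_of_le_ne_top ENNReal.ofReal_ne_top hle
  calc _ ≤ gammaBarIdx (upperConj σ τ)
        + (ENNReal.ofReal g - gammaBarIdx (upperConj σ τ)) := by
        gcongr
        exact iSup₂_le fun b hb => ENNReal.le_sub_of_add_le_left hfin (key b hb)
    _ = _ := add_tsub_cancel_of_le hle

lemma exists_upperConj_le {σ σ' τ τ' : ℝ → ℝ} (hτ : IsWeightFct τ)
    (hwd : UpperConjWD σ τ) {b : ℝ} (hb : 0 < b) (hb' : gammaBarProp τ b)
    (hσσ' : ∃ A D : ℝ, 0 < A ∧ ∀ t, 0 ≤ t → σ' t ≤ A * σ t + D)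
    (hττ' : ∃ A D : ℝ, 0 < A ∧ ∀ t, 0 ≤ t → τ t ≤ A * τ' t + D) :
    ∃ A B D : ℝ, 0 < A ∧ 0 < B ∧
      ∀ t, 0 < t → upperConj σ' τ' t ≤ A * upperConj σ τ (B * t) + D := by
  obtain ⟨A, D, hA, h1⟩ := hσσ'
  obtain ⟨C, E, hC, h2⟩ := hττ'
  obtain ⟨K, ⟨F, hF⟩, hK⟩ := ((eventually_le_scaling hτ hb hb' (mul_pos hC hA)).and
    (eventually_ge_atTop 1)).exists
  have hK0 : 0 < K := zero_lt_one.trans_le hK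
  have hKb := Real.rpow_pos_of_pos hK0 b
  refine ⟨A, K ^ b, D + (F + E) / C, hA, hKb, fun t ht => upperConj_le ht fun s hs => ?_⟩
  have h3 := h1 s hs
  have h4 := h2 (s / t) (by positivity)
  have h5 := hF (s / (K ^ b * t)) (by positivity)
  have e : K ^ b * (s / (K ^ b * t)) = s / t := by field_simp
  rw [e] at h5
  have h6 := mul_le_mul_of_nonneg_left (le_upperConj hwd (mul_pos hKb ht) hs) hA.le
  have h7 : C * A * τ (s / (K ^ b * t)) ≤ C * A * K * τ (s / (K ^ b * t)) := by
    refine mul_le_mul_of_nonneg_right ?_ (hτ.1 _)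
    exact le_mul_of_one_le_right (mul_pos hC hA).le hK
  have h8 : A * τ (s / (K ^ b * t)) ≤ τ' (s / t) + (F + E) / C := by
    rw [← sub_le_iff_le_add', le_div_iff₀ hC]
    linarith
  linarith

lemma isWeightFct_abs_rpow {r : ℝ} (hr : 0 < r) : IsWeightFct fun v : ℝ => |v| ^ r := by
  refine ⟨fun t => by positivity, fun s hs t ht hst => ?_,
    (tendsto_rpow_atTop hr).comp tendsto_abs_atTop_atTop⟩
  rw [mem_Ici] at hs ht
  simp only [abs_of_nonneg hs, abs_of_nonneg ht]
  exact Real.rpow_le_rpow hs hst hr.le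

lemma abs_rpow_scaling {α : ℝ} (g : ℝ) {K t : ℝ} (hK : 0 < K) :
    |K ^ g * t| ^ (1 / α) = K ^ (g / α) * |t| ^ (1 / α) := by
  rw [abs_mul, abs_of_pos (Real.rpow_pos_of_pos hK g),
    Real.mul_rpow (Real.rpow_pos_of_pos hK g).le (abs_nonneg t), ← Real.rpow_mul hK.le,
    mul_one_div]

lemma le_gammaIdx_abs_rpow {α : ℝ} (hα : 0 < α) :
    ENNReal.ofReal α ≤ gammaIdx fun v : ℝ => |v| ^ (1 / α) := by
  refine le_of_forall_lt fun c hc => ?_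
  obtain ⟨g, hg1, hg2⟩ := exists_between hc
  have hg' := hg2.ne_top
  have hg0 : 0 < g.toReal := ENNReal.toReal_pos (bot_le.trans_lt hg1).ne' hg'
  have hgα : g.toReal < α := (ENNReal.lt_ofReal_iff_toReal_lt hg').1 hg2
  refine hg1.trans_le ?_
  rw [← ENNReal.ofReal_toReal hg']
  refine le_iSup₂_of_le (f := fun (b : ℝ) (_ : 0 < b ∧ gammaProp _ b) => ENNReal.ofReal b)
    g.toReal ⟨hg0, ?_⟩ le_rfl
  refine (gammaProp_iff (isWeightFct_abs_rpow (one_div_pos.2 hα)).2.2 _).2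
    ⟨2, 2 ^ (g.toReal / α), one_lt_two, by positivity, ?_, ?_⟩
  · exact Real.rpow_lt_self_of_one_lt one_lt_two ((div_lt_one hα).2 hgα)
  · exact Eventually.of_forall fun t => (abs_rpow_scaling _ two_pos).le

lemma gammaBarIdx_abs_rpow_le {α : ℝ} (hα : 0 < α) :
    (gammaBarIdx fun v : ℝ => |v| ^ (1 / α)) ≤ ENNReal.ofReal α := by
  refine le_of_forall_gt fun c hc => ?_
  obtain ⟨g, hg1, hg2⟩ := exists_between hc
  have hg' := hg2.ne_top
  have hgα : α < g.toReal := (ENNReal.ofReal_lt_iff_lt_toReal hα.le hg').1 hg1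
  refine lt_of_le_of_lt (sInf_le ⟨g.toReal, ⟨hα.trans hgα, ?_⟩, ENNReal.ofReal_toReal hg'⟩) hg2
  refine (gammaBarProp_iff (isWeightFct_abs_rpow (one_div_pos.2 hα)).2.2 _).2
    ⟨2, 2 ^ (g.toReal / α), one_lt_two, ?_, ?_⟩
  · exact Real.self_lt_rpow_of_one_lt one_lt_two ((one_lt_div hα).2 hgα)
  · exact Eventually.of_forall fun t => (abs_rpow_scaling _ two_pos).ge

lemma upperCompose_eq_upperConj (ω : ℝ → ℝ) {α : ℝ} (hα : 0 < α) {t : ℝ} (ht : 0 < t) :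
    upperCompose ω α t = upperConj ω (fun v => |v| ^ (1 / α)) t := by
  have key : ∀ s, 0 ≤ s → |s / t| ^ (1 / α) = 1 / t ^ (1 / α) * s ^ (1 / α) := by
    intro s hs
    rw [abs_of_nonneg (by positivity), Real.div_rpow hs ht.le]
    ring
  rw [upperCompose, upperEnv, upperConj, if_neg ht.ne']
  congr 1
  ext z
  constructor
  · rintro ⟨s, hs, rfl⟩
    refine ⟨s ^ α, by positivity, ?_⟩
    simp only [key _ (Real.rpow_nonneg hs α), ← Real.rpow_mul hs, mul_one_div_cancel hα.ne',
      Real.rpow_one]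
  · rintro ⟨s, hs, rfl⟩
    refine ⟨s ^ (1 / α), by positivity, ?_⟩
    simp only [key _ hs, ← Real.rpow_mul hs, one_div_mul_cancel hα.ne', Real.rpow_one]

lemma tendsto_upperCompose_div {ω : ℝ → ℝ} {α : ℝ} (hα : 0 < α)
    (h : Tendsto (upperConj ω fun v => |v| ^ (1 / α)) atTop atTop) :
    Tendsto (fun t => upperCompose ω α t / upperConj ω (fun v => |v| ^ (1 / α)) t) atTop
      (𝓝 1) := by
  refine tendsto_const_nhds.congr' ?_
  filter_upwards [h.eventually_ne_atTop 0, eventually_gt_atTop 0] with t ht ht0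
  rw [upperCompose_eq_upperConj ω hα ht0, div_self ht]

lemma gammaIdx_le_gammaIdx_upperCompose_add {ω : ℝ → ℝ} (hω : IsWeightFct ω) {α : ℝ}
    (hα : 0 < α) (h : ENNReal.ofReal α < gammaIdx ω) :
    gammaIdx ω ≤ gammaIdx (upperCompose ω α) + ENNReal.ofReal α := by
  have hid := isWeightFct_abs_rpow (one_div_pos.2 hα)
  have hlim := tendsto_upperConj hω
    (upperConjWD_of_gammaBarIdx_lt hω hid ((gammaBarIdx_abs_rpow_le hα).trans_lt h))
  rw [gammaIdx_eq_of_tendsto_div one_pos hlim (tendsto_upperCompose_div hα hlim)]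
  refine (gammaIdx_le_gammaIdx_upperConj_add hω hid).trans ?_
  gcongr
  exact gammaBarIdx_abs_rpow_le hα

lemma gammaBarIdx_upperCompose_add_le {ω : ℝ → ℝ} (hω : IsWeightFct ω) {α : ℝ}
    (hα : 0 < α) (h : ENNReal.ofReal α < gammaIdx ω) :
    gammaBarIdx (upperCompose ω α) + ENNReal.ofReal α ≤ gammaBarIdx ω := by
  have hid := isWeightFct_abs_rpow (one_div_pos.2 hα)
  have hlt := (gammaBarIdx_abs_rpow_le hα).trans_lt h
  have hlim := tendsto_upperConj hω (upperConjWD_of_gammaBarIdx_lt hω hid hlt)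
  rw [gammaBarIdx_eq_of_tendsto_div one_pos hlim (tendsto_upperCompose_div hα hlim)]
  refine le_trans ?_ (gammaBarIdx_upperConj_add_le hω hid
    ((ENNReal.ofReal_pos.2 hα).trans_le (le_gammaIdx_abs_rpow hα)) hlt)
  gcongr
  exact le_gammaIdx_abs_rpow hα

lemma gammaIdx_upperConj_omegaSeq_le {σ τ : ℝ → ℝ} (hσ : IsW0 σ) (hτ : IsW0 τ)
    (h : gammaBarIdx τ < gammaIdx σ) {a b c d : ℝ} (ha : 0 < a) (hb : 0 < b) (hc : 0 < c)
    (hd : 0 < d) :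
    gammaIdx (upperConj (omegaSeq (assocSeq σ a)) (omegaSeq (assocSeq τ b)))
      ≤ gammaBarIdx (upperConj (omegaSeq (assocSeq σ c)) (omegaSeq (assocSeq τ d))) := by
  have hwd : ∀ {x y : ℝ}, 0 < x → 0 < y →
      UpperConjWD (omegaSeq (assocSeq σ x)) (omegaSeq (assocSeq τ y)) := fun hx hy =>
    upperConjWD_of_gammaBarIdx_lt (isWeightFct_omegaSeq hσ hx) (isWeightFct_omegaSeq hτ hy)
      (by rwa [gammaIdx_omegaSeq hσ hx, gammaBarIdx_omegaSeq hτ hy])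
  have hcomp : ∀ {ω : ℝ → ℝ}, IsW0 ω → ∀ {x y : ℝ}, 0 < x → 0 < y → ∃ A D : ℝ, 0 < A ∧
      ∀ t, 0 ≤ t → omegaSeq (assocSeq ω x) t ≤ A * omegaSeq (assocSeq ω y) t + D :=
    fun hω _ _ hx hy => exists_le_mul_add_of_tendsto_div (isWeightFct_omegaSeq hω hx)
      (isWeightFct_omegaSeq hω hy) (by positivity) (tendsto_omegaSeq_div_omegaSeq hω hx hy)
  have hlt := h.trans_le le_top
  rw [← gammaBarIdx_omegaSeq hτ hb] at hlt
  obtain ⟨_, ⟨g, hg, rfl⟩, -⟩ := sInf_lt_iff.1 hlt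
  obtain ⟨A, B, D, hA, hB, H⟩ := exists_upperConj_le (isWeightFct_omegaSeq hτ hb) (hwd ha hb)
    hg.1 hg.2 (hcomp hσ hc ha) (hcomp hτ hb hd)
  exact gammaIdx_le_gammaBarIdx_of_le
    (isWeightFct_upperConj (isWeightFct_omegaSeq hσ ha) (isWeightFct_omegaSeq hτ hb)
      (omegaSeq_zero hτ hb) (hwd ha hb))
    (isWeightFct_upperConj (isWeightFct_omegaSeq hσ hc) (isWeightFct_omegaSeq hτ hd)
      (omegaSeq_zero hτ hd) (hwd hc hd)) hA hB H

theorem stmt16 (σ τ : ℝ → ℝ) (hσ : IsW0 σ) (hτ : IsW0 τ) :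
    (∀ α : ℝ, 0 < α → (σ =o[atTop] fun s : ℝ => s ^ (1 / α)) →
      ENNReal.ofReal α < gammaIdx σ →
      (∀ ℓ : ℝ, 0 < ℓ → ∀ ℓ₁ : ℝ, 0 < ℓ₁ →
        gammaIdx (omegaSeq (assocSeq σ ℓ₁))
          ≤ gammaIdx (upperCompose (omegaSeq (assocSeq σ ℓ)) α) + ENNReal.ofReal α) ∧
      (gammaBarIdx σ < ⊤ →
        ∀ ℓ : ℝ, 0 < ℓ → ∀ ℓ₁ : ℝ, 0 < ℓ₁ →
          gammaBarIdx (upperCompose (omegaSeq (assocSeq σ ℓ)) α) + ENNReal.ofReal α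
            ≤ gammaBarIdx (omegaSeq (assocSeq σ ℓ₁)))) ∧
    (((∃ x : ℝ, 0 < x ∧ ∃ y : ℝ, 0 < y ∧
          UpperConjWD (omegaSeq (assocSeq σ x)) (omegaSeq (assocSeq τ y))) ∨
        UpperConjWD σ τ) →
      0 < gammaIdx τ → gammaIdx τ = gammaBarIdx τ → gammaBarIdx τ < gammaIdx σ →
      gammaIdx σ ≤ gammaBarIdx σ → gammaBarIdx σ < ⊤ →
      ∀ ℓ₁ : ℝ, 0 < ℓ₁ → ∀ ℓ₂ : ℝ, 0 < ℓ₂ → ∀ ℓ₃ : ℝ, 0 < ℓ₃ → ∀ ℓ₄ : ℝ, 0 < ℓ₄ →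
      ∀ ℓ₅ : ℝ, 0 < ℓ₅ → ∀ ℓ₆ : ℝ, 0 < ℓ₆ → ∀ ℓ₇ : ℝ, 0 < ℓ₇ → ∀ ℓ₈ : ℝ, 0 < ℓ₈ →
        gammaIdx (omegaSeq (assocSeq σ ℓ₁))
            ≤ gammaIdx (upperConj (omegaSeq (assocSeq σ ℓ₂)) (omegaSeq (assocSeq τ ℓ₃)))
                + gammaBarIdx (omegaSeq (assocSeq τ ℓ₄)) ∧
        gammaIdx (upperConj (omegaSeq (assocSeq σ ℓ₂)) (omegaSeq (assocSeq τ ℓ₃)))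
              + gammaBarIdx (omegaSeq (assocSeq τ ℓ₄))
            ≤ gammaBarIdx (upperConj (omegaSeq (assocSeq σ ℓ₅)) (omegaSeq (assocSeq τ ℓ₆)))
                + gammaIdx (omegaSeq (assocSeq τ ℓ₇)) ∧
        gammaBarIdx (upperConj (omegaSeq (assocSeq σ ℓ₅)) (omegaSeq (assocSeq τ ℓ₆)))
              + gammaIdx (omegaSeq (assocSeq τ ℓ₇))
            ≤ gammaBarIdx (omegaSeq (assocSeq σ ℓ₈))) := by
  refine ⟨fun α hα _ h => ⟨fun ℓ hℓ ℓ₁ hℓ₁ => ?_, fun _ ℓ hℓ ℓ₁ hℓ₁ => ?_⟩, ?_⟩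
  · rw [gammaIdx_omegaSeq hσ hℓ₁, ← gammaIdx_omegaSeq hσ hℓ]
    exact gammaIdx_le_gammaIdx_upperCompose_add (isWeightFct_omegaSeq hσ hℓ) hα
      (by rwa [gammaIdx_omegaSeq hσ hℓ])
  · rw [gammaBarIdx_omegaSeq hσ hℓ₁, ← gammaBarIdx_omegaSeq hσ hℓ]
    exact gammaBarIdx_upperCompose_add_le (isWeightFct_omegaSeq hσ hℓ) hα
      (by rwa [gammaIdx_omegaSeq hσ hℓ])
  · intro _ hpos heq hlt _ _ ℓ₁ h₁ ℓ₂ h₂ ℓ₃ h₃ ℓ₄ h₄ ℓ₅ h₅ ℓ₆ h₆ ℓ₇ h₇ ℓ₈ h₈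
    refine ⟨?_, ?_, ?_⟩
    · have := gammaIdx_le_gammaIdx_upperConj_add (isWeightFct_omegaSeq hσ h₂)
        (isWeightFct_omegaSeq hτ h₃)
      rwa [gammaIdx_omegaSeq hσ h₂, gammaBarIdx_omegaSeq hτ h₃, ← gammaIdx_omegaSeq hσ h₁,
        ← gammaBarIdx_omegaSeq hτ h₄] at this
    · rw [gammaBarIdx_omegaSeq hτ h₄, gammaIdx_omegaSeq hτ h₇, heq]
      gcongr
      exact gammaIdx_upperConj_omegaSeq_le hσ hτ hlt h₂ h₃ h₅ h₆
    · rw [gammaIdx_omegaSeq hτ h₇, gammaBarIdx_omegaSeq hσ h₈, ← gammaIdx_omegaSeq hτ h₆,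
        ← gammaBarIdx_omegaSeq hσ h₅]
      exact gammaBarIdx_upperConj_add_le (isWeightFct_omegaSeq hσ h₅)
        (isWeightFct_omegaSeq hτ h₆) (by rwa [gammaIdx_omegaSeq hτ h₆])
        (by rwa [gammaBarIdx_omegaSeq hτ h₆, gammaIdx_omegaSeq hσ h₅])
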